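/- arXiv:1606.01200 — 5 statements merged into one kernel-verified Lean document; each statement's English description precedes it below -/
import Mathlib

section
/- Let γ_b > 0 > γ_s, r = γ_b/(γ_b − γ_s), and let S, B > 0 and C_n > 0 be a sequence of positive reals. Let R̃ : [0,∞)² → [0,∞) satisfy R̃(b,s) > 0 for (b,s) ≠ (0,0) and R̃(tb,ts) = t·R̃(b,s) for all t ≥ 0, and let R_n : (0,∞) → [0,∞) be a sequence of functions. Assume: (a) for every sequence h_n > 0 with 0 < liminf h_n·(nC_n²)^{1/(2(γ_b−γ_s))} and limsup h_n·(nC_n²)^{1/(2(γ_b−γ_s))} < ∞, one has R_n(h_n)/R̃(h_n^{γ_b} C_n B, h_n^{γ_s} n^{−1/2} S) → 1; (b) for every sequence h_n > 0 with h_n·(nC_n²)^{1/(2(γ_b−γ_s))} → ∞ or → 0, one has C_n^{r−1} n^{r/2} R_n(h_n) → ∞; (c) the function t ↦ t^{r−1} R̃(t,1) on (0,∞) has a unique minimizer t* > 0. Then C_n^{r−1} n^{r/2} · inf_{h>0} R_n(h) → S^r B^{1−r} · inf_{t>0} t^{r−1} R̃(t,1), and moreover C_n^{r−1} n^{r/2}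 · R_n(h*_n) converges to the same limit, where h*_n = (n^{−1/2} S t*/(C_n B))^{1/(γ_b−γ_s)}. -/
open Filter Topology

/-- The rescaled bandwidth `h_n · (n C_n²)^{1/(2(γ_b−γ_s))}`. -/
noncomputable def scaledBW (γb γs : ℝ) (C : ℕ → ℝ) (h : ℕ → ℝ) (n : ℕ) : ℝ :=
  h n * ((n : ℝ) * (C n) ^ 2) ^ (1 / (2 * (γb - γs)))

/-- A bandwidth sequence is *regular* if `0 < liminf h_n·(nC_n²)^{1/(2(γ_b−γ_s))}` and
`limsup h_n·(nC_n²)^{1/(2(γ_b−γ_s))} < ∞`, phrased via eventual two-sided bounds. -/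
def RegularBW (γb γs : ℝ) (C : ℕ → ℝ) (h : ℕ → ℝ) : Prop :=
  ∃ c₁ c₂ : ℝ, 0 < c₁ ∧
    ∀ᶠ n in atTop, c₁ ≤ scaledBW γb γs C h n ∧ scaledBW γb γs C h n ≤ c₂

/-- Values prescribed along a subsequence, with a default elsewhere, inherit a common limit. -/
lemma StrictMono.tendsto_extend {α : Type*} {φ : ℕ → ℕ} (hφ : StrictMono φ) {u d : ℕ → α}
    {l : Filter α} (hu : Tendsto u atTop l) (hd : Tendsto d atTop l) :
    Tendsto (Function.extend φ u d) atTop l := by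
  refine tendsto_def.2 fun s hs => ?_
  obtain ⟨k₀, hk₀⟩ := eventually_atTop.1 (hu.eventually hs)
  filter_upwards [hd.eventually hs, eventually_ge_atTop (φ k₀)] with n hn hn'
  by_cases h : ∃ k, φ k = n
  · obtain ⟨k, rfl⟩ := h
    rw [Set.mem_preimage, hφ.injective.extend_apply]
    exact hk₀ k (hφ.le_iff_le.1 hn')
  · rw [Set.mem_preimage, Function.extend_apply' _ _ _ h]
    exact hn

lemma StrictMono.extend_pos {φ : ℕ → ℕ} (hφ : StrictMono φ) {u d : ℕ → ℝ}
    (hu : ∀ n, 0 < u n) (hd : ∀ n, 0 < d n) (n : ℕ) : 0 < Function.extend φ u d n := by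
  by_cases h : ∃ k, φ k = n
  · obtain ⟨k, rfl⟩ := h
    rw [hφ.injective.extend_apply]
    exact hu k
  · rw [Function.extend_apply' _ _ _ h]
    exact hd n

/-- A sequence of positive reals has a subsequence converging to a positive real, to `0`,
or to infinity. -/
lemma exists_subseq_tendsto_of_pos {x : ℕ → ℝ} (hx : ∀ n, 0 < x n) :
    ∃ ψ : ℕ → ℕ, StrictMono ψ ∧ ((∃ a, 0 < a ∧ Tendsto (x ∘ ψ) atTop (𝓝 a)) ∨
      Tendsto (x ∘ ψ) atTop (𝓝 0) ∨ Tendsto (x ∘ ψ) atTop atTop) := by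
  obtain ⟨a, ψ, hψ, ha⟩ := CompactSpace.tendsto_subseq (fun n => ENNReal.ofReal (x n))
  refine ⟨ψ, hψ, ?_⟩
  by_cases htop : a = ⊤
  · subst htop
    exact Or.inr (Or.inr (ENNReal.tendsto_ofReal_nhds_top.1 ha))
  · have h := (ENNReal.tendsto_toReal htop).comp ha
    have hcomp : ENNReal.toReal ∘ (fun n => ENNReal.ofReal (x n)) ∘ ψ = x ∘ ψ := by
      funext n
      exact ENNReal.toReal_ofReal (hx _).le
    rw [hcomp] at h
    rcases (ENNReal.toReal_nonneg (a := a)).eq_or_lt with h0 | h0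
    · exact Or.inr (Or.inl (h0 ▸ h))
    · exact Or.inl ⟨_, h0, h⟩

/-- If `F n` is asymptotically equivalent to `G` along sequences converging in `(0, ∞)` and
diverges along sequences escaping to `0` or `∞`, then it is eventually bounded below,
uniformly on `(0, ∞)`, by anything less than a positive lower bound of `G`. -/
lemma eventually_forall_pos_le_of_tendsto_div {F : ℕ → ℝ → ℝ} {G : ℝ → ℝ} {m c : ℝ}
    (hm : 0 < m) (hG : ∀ x, 0 < x → m ≤ G x)
    (hlim : ∀ x : ℕ → ℝ, (∀ n, 0 < x n) → ∀ a, 0 < a → Tendsto x atTop (𝓝 a) →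
      Tendsto (fun n => F n (x n) / G (x n)) atTop (𝓝 1))
    (hesc : ∀ x : ℕ → ℝ, (∀ n, 0 < x n) → (Tendsto x atTop atTop ∨ Tendsto x atTop (𝓝 0)) →
      Tendsto (fun n => F n (x n)) atTop atTop)
    (hc : c < m) : ∀ᶠ n in atTop, ∀ x, 0 < x → c ≤ F n x := by
  by_contra hcon
  obtain ⟨φ, hφ, hbad⟩ := extraction_of_frequently_atTop (not_eventually.1 hcon)
  push Not at hbad
  choose x hx hFx using hbad
  obtain ⟨ψ, hψ, hcases⟩ := exists_subseq_tendsto_of_pos hx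
  have hχ : StrictMono (φ ∘ ψ) := hφ.comp hψ
  have hdiv : ∀ d : ℕ → ℝ, (∀ n, 0 < d n) →
      ¬ Tendsto (fun n => F n (Function.extend (φ ∘ ψ) (x ∘ ψ) d n)) atTop atTop := by
    intro d _ h
    obtain ⟨k, hk⟩ := ((h.comp hχ.tendsto_atTop).eventually_ge_atTop c).exists
    simp only [Function.comp_apply] at hk
    rw [← Function.comp_apply (f := φ), hχ.injective.extend_apply] at hk
    exact absurd hk (not_le.2 (hFx _))
  rcases hcases with ⟨a, ha, h⟩ | h | h
  · have hlim' := (hlim _ (hχ.extend_pos (fun n => hx (ψ n)) fun _ => ha) a ha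
      (hχ.tendsto_extend h tendsto_const_nhds)).comp hχ.tendsto_atTop
    have hlt : max c 0 / m < 1 := (div_lt_one hm).2 (max_lt hc hm)
    obtain ⟨k, hk⟩ := (hlim'.eventually (lt_mem_nhds hlt)).exists
    simp only [Function.comp_apply] at hk
    rw [← Function.comp_apply (f := φ), hχ.injective.extend_apply] at hk
    have hGk := hG _ (hx (ψ k))
    simp only [Function.comp_apply] at hk
    rw [lt_div_iff₀ (hm.trans_le hGk)] at hk
    have h1 : max c 0 ≤ max c 0 / m * G (x (ψ k)) := by
      rw [div_mul_eq_mul_div, le_div_iff₀ hm]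
      exact mul_le_mul_of_nonneg_left hGk (le_max_right _ _)
    linarith [hFx (ψ k), le_max_left c 0]
  · have hpos : ∀ n : ℕ, 0 < 1 / ((n : ℝ) + 1) := fun n => by positivity
    exact hdiv _ hpos (hesc _ (hχ.extend_pos (fun n => hx (ψ n)) hpos)
      (Or.inr (hχ.tendsto_extend h tendsto_one_div_add_atTop_nhds_zero_nat)))
  · have hpos : ∀ n : ℕ, 0 < (n : ℝ) + 1 := fun n => by positivity
    exact hdiv _ hpos (hesc _ (hχ.extend_pos (fun n => hx (ψ n)) hpos)
      (Or.inl (hχ.tendsto_extend h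
        (tendsto_atTop_add_const_right _ 1 tendsto_natCast_atTop_atTop))))

/-- The rate normalization turns the criterion at the bias and standard deviation of
bandwidth `h` into a function of the bias-to-standard-deviation ratio alone. -/
lemma normalized_criterion_eq {γb γs r S B c N h : ℝ} (hδ : 0 < γb - γs)
    (hr : r = γb / (γb - γs)) (hS : 0 < S) (hB : 0 < B) (hc : 0 < c) (hN : 0 < N) (hh : 0 < h)
    {R' : ℝ → ℝ → ℝ}
    (hR'hom : ∀ t b s : ℝ, 0 ≤ t → 0 ≤ b → 0 ≤ s → R' (t * b) (t * s) = t * R' b s)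
    {t : ℝ} (ht : t = (h * (N * c ^ 2) ^ (1 / (2 * (γb - γs)))) ^ (γb - γs) * B / S) :
    c ^ (r - 1) * N ^ (r / 2) * R' (h ^ γb * c * B) (h ^ γs * N ^ (-(1 : ℝ) / 2) * S) =
      S ^ r * B ^ (1 - r) * (t ^ (r - 1) * R' t 1) := by
  have ht0 : 0 < t := by rw [ht]; positivity
  have hδ0 := hδ.ne'
  obtain ⟨s, hs⟩ : ∃ s, s = h ^ γs * N ^ (-(1 : ℝ) / 2) * S := ⟨_, rfl⟩
  have hs0 : 0 < s := by rw [hs]; positivity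
  have hst : h ^ γb * c * B = s * t ∧
      c ^ (r - 1) * N ^ (r / 2) * s = S ^ r * B ^ (1 - r) * t ^ (r - 1) := by
    rw [ht, hs, hr]
    obtain ⟨S, rfl⟩ : ∃ y, S = Real.exp y := ⟨_, (Real.exp_log hS).symm⟩
    obtain ⟨B, rfl⟩ : ∃ y, B = Real.exp y := ⟨_, (Real.exp_log hB).symm⟩
    obtain ⟨c, rfl⟩ : ∃ y, c = Real.exp y := ⟨_, (Real.exp_log hc).symm⟩
    obtain ⟨N, rfl⟩ : ∃ y, N = Real.exp y := ⟨_, (Real.exp_log hN).symm⟩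
    obtain ⟨h, rfl⟩ : ∃ y, h = Real.exp y := ⟨_, (Real.exp_log hh).symm⟩
    constructor <;>
    · simp only [← Real.exp_mul, ← Real.exp_add, ← Real.exp_sub, ← Real.exp_nat_mul,
        Real.exp_eq_exp]
      push_cast
      field_simp
      ring
  have hhom := hR'hom s t 1 hs0.le ht0.le zero_le_one
  rw [mul_one] at hhom
  rw [← hs, hst.1, hhom, ← mul_assoc, hst.2, mul_assoc]

/-- Theorem 2.1(i) of the paper: asymptotic minimax performance.
`R n h` is the worst-case performance of the estimator with bandwidth `h` at sample size
`n`, and `R' b s` the value of the criterion for a normal estimator with bias `b` and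
standard deviation `s`.  Under (a) the asymptotic approximation of `R n` by
`R̃(h^{γb} C_n B, h^{γs} n^{−1/2} S)` along regular bandwidth sequences, (b) divergence of
the normalized risk along too-small or too-large bandwidth sequences, and (c) uniqueness
of the positive minimizer `t*` of `t ↦ t^{r−1} R̃(t,1)`, the normalized minimax risk
`C_n^{r−1} n^{r/2} inf_{h>0} R_n(h)` converges to `S^r B^{1−r} inf_{t>0} t^{r−1} R̃(t,1)`,
and the risk at the optimal bandwidth `h*_n = (n^{−1/2} S t*/(C_n B))^{1/(γb−γs)}`
converges to the same limit. -/
theorem stmt0 (γb γs r : ℝ) (hγb : 0 < γb) (hγs : γs < 0)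
    (hr : r = γb / (γb - γs))
    (S B : ℝ) (hS : 0 < S) (hB : 0 < B)
    (C : ℕ → ℝ) (hC : ∀ n, 0 < C n)
    (R' : ℝ → ℝ → ℝ)
    (hR'nonneg : ∀ b s : ℝ, 0 ≤ b → 0 ≤ s → 0 ≤ R' b s)
    (hR'pos : ∀ b s : ℝ, 0 ≤ b → 0 ≤ s → ¬(b = 0 ∧ s = 0) → 0 < R' b s)
    (hR'hom : ∀ t b s : ℝ, 0 ≤ t → 0 ≤ b → 0 ≤ s → R' (t * b) (t * s) = t * R' b s)
    (R : ℕ → ℝ → ℝ) (hRnonneg : ∀ n : ℕ, ∀ h : ℝ, 0 < h → 0 ≤ R n h)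
    (hconva : ∀ h : ℕ → ℝ, (∀ n, 0 < h n) → RegularBW γb γs C h →
      Tendsto (fun n : ℕ => R n (h n) /
        R' ((h n) ^ γb * C n * B) ((h n) ^ γs * (n : ℝ) ^ (-(1 : ℝ) / 2) * S))
        atTop (𝓝 1))
    (hconvb : ∀ h : ℕ → ℝ, (∀ n, 0 < h n) →
      (Tendsto (scaledBW γb γs C h) atTop atTop ∨
        Tendsto (scaledBW γb γs C h) atTop (𝓝 0)) →
      Tendsto (fun n : ℕ => (C n) ^ (r - 1) * (n : ℝ) ^ (r / 2) * R n (h n)) atTop atTop)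
    (tstar : ℝ) (htstar : 0 < tstar)
    (hmin : ∀ t : ℝ, 0 < t → t ≠ tstar →
      tstar ^ (r - 1) * R' tstar 1 < t ^ (r - 1) * R' t 1) :
    Tendsto (fun n : ℕ => (C n) ^ (r - 1) * (n : ℝ) ^ (r / 2) *
        sInf ((fun h : ℝ => R n h) '' Set.Ioi (0 : ℝ))) atTop
      (𝓝 (S ^ r * B ^ (1 - r) *
        sInf ((fun t : ℝ => t ^ (r - 1) * R' t 1) '' Set.Ioi (0 : ℝ)))) ∧
    Tendsto (fun n : ℕ => (C n) ^ (r - 1) * (n : ℝ) ^ (r / 2) *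
        R n (((n : ℝ) ^ (-(1 : ℝ) / 2) * S * tstar / (C n * B)) ^ (1 / (γb - γs))))
      atTop
      (𝓝 (S ^ r * B ^ (1 - r) *
        sInf ((fun t : ℝ => t ^ (r - 1) * R' t 1) '' Set.Ioi (0 : ℝ)))) := by
  have hδ : 0 < γb - γs := by linarith
  have hδ0 := hδ.ne'
  obtain ⟨K, hK⟩ : ∃ K, K = S ^ r * B ^ (1 - r) := ⟨_, rfl⟩
  obtain ⟨g, hg⟩ : ∃ g : ℝ → ℝ, g = fun t => t ^ (r - 1) * R' t 1 := ⟨_, rfl⟩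
  obtain ⟨G, hGdef⟩ : ∃ G : ℝ → ℝ, G = fun x => K * g (x ^ (γb - γs) * B / S) := ⟨_, rfl⟩
  obtain ⟨σ, hσ⟩ : ∃ σ : ℕ → ℝ, σ = fun n : ℕ =>
    ((n : ℝ) * (C n) ^ 2) ^ (1 / (2 * (γb - γs))) := ⟨_, rfl⟩
  obtain ⟨A, hA⟩ : ∃ A : ℕ → ℝ, A = fun n : ℕ =>
    (C n) ^ (r - 1) * (n : ℝ) ^ (r / 2) := ⟨_, rfl⟩
  have hK0 : 0 < K := by rw [hK]; positivity
  have hgmin : ∀ t, 0 < t → g tstar ≤ g t := by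
    intro t ht
    rcases eq_or_ne t tstar with rfl | hne
    · exact le_rfl
    · rw [hg]; exact (hmin t ht hne).le
  have hgstar : 0 < g tstar := by
    rw [hg]
    exact mul_pos (Real.rpow_pos_of_pos htstar _)
      (hR'pos _ _ htstar.le zero_le_one fun h => one_ne_zero h.2)
  have hInf : sInf (g '' Set.Ioi (0 : ℝ)) = g tstar := by
    refine IsLeast.csInf_eq ⟨⟨tstar, htstar, rfl⟩, ?_⟩
    rintro _ ⟨t, ht, rfl⟩
    exact hgmin t ht
  have hn0 : ∀ {n : ℕ}, n ≠ 0 → 0 < (n : ℝ) := fun hn => by positivity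
  have hσ0 : ∀ {n : ℕ}, n ≠ 0 → 0 < σ n := by
    intro n hn
    have := hn0 hn
    have := hC n
    rw [hσ]
    positivity
  have hA0 : ∀ {n : ℕ}, n ≠ 0 → 0 < A n := by
    intro n hn
    have := hn0 hn
    have := hC n
    rw [hA]
    positivity
  have hGeq : ∀ {n : ℕ}, n ≠ 0 → ∀ h, 0 < h →
      A n * R' (h ^ γb * C n * B) (h ^ γs * (n : ℝ) ^ (-(1 : ℝ) / 2) * S) = G (h * σ n) := by
    intro n hn h hh
    rw [hA, hGdef, hg, hσ, hK]
    exact normalized_criterion_eq hδ hr hS hB (hC n) (hn0 hn) hh hR'hom rfl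
  have hGmin : ∀ x, 0 < x → K * g tstar ≤ G x := by
    intro x hx
    rw [hGdef]
    exact mul_le_mul_of_nonneg_left (hgmin _ (by positivity)) hK0.le
  have hlift : ∀ x : ℕ → ℝ, (∀ n, 0 < x n) → ∃ h : ℕ → ℝ, (∀ n, 0 < h n) ∧
      (∀ n, n ≠ 0 → h n = x n / σ n) ∧ scaledBW γb γs C h =ᶠ[atTop] x := by
    intro x hx
    refine ⟨fun n => if n = 0 then 1 else x n / σ n, fun n => ?_, fun n hn => if_neg hn, ?_⟩
    · dsimp only
      split_ifs with hn
      · exact one_pos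
      · exact div_pos (hx n) (hσ0 hn)
    · filter_upwards [eventually_ne_atTop 0] with n hn
      have hsc : scaledBW γb γs C (fun n => if n = 0 then 1 else x n / σ n) n =
          (if n = 0 then 1 else x n / σ n) * σ n := by
        rw [hσ]; rfl
      rw [hsc, if_neg hn, div_mul_cancel₀ _ (hσ0 hn).ne']
  have hlim : ∀ x : ℕ → ℝ, (∀ n, 0 < x n) → ∀ a, 0 < a → Tendsto x atTop (𝓝 a) →
      Tendsto (fun n => A n * R n (x n / σ n) / G (x n)) atTop (𝓝 1) := by
    intro x hx a ha hxa
    obtain ⟨h, hpos, heq, hsc⟩ := hlift x hx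
    refine (hconva h hpos ⟨a / 2, 2 * a, by positivity, ?_⟩).congr' ?_
    · filter_upwards [hsc, hxa.eventually (Icc_mem_nhds (half_lt_self ha)
        (by linarith : a < 2 * a))] with n hn hn'
      rw [hn]
      exact hn'
    · filter_upwards [eventually_ne_atTop 0] with n hn
      have hxn : x n = h n * σ n := by rw [heq n hn, div_mul_cancel₀ _ (hσ0 hn).ne']
      rw [← heq n hn, hxn, ← hGeq hn _ (hpos n), mul_div_mul_left _ _ (hA0 hn).ne']
  have hesc : ∀ x : ℕ → ℝ, (∀ n, 0 < x n) →
      (Tendsto x atTop atTop ∨ Tendsto x atTop (𝓝 0)) →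
      Tendsto (fun n => A n * R n (x n / σ n)) atTop atTop := by
    intro x hx hx'
    obtain ⟨h, hpos, heq, hsc⟩ := hlift x hx
    refine (hconvb h hpos (hx'.imp (fun H => H.congr' hsc.symm)
      fun H => H.congr' hsc.symm)).congr' ?_
    filter_upwards [eventually_ne_atTop 0] with n hn
    rw [heq n hn, hA]
  have hopt : Tendsto (fun n : ℕ => A n *
      R n (((n : ℝ) ^ (-(1 : ℝ) / 2) * S * tstar / (C n * B)) ^ (1 / (γb - γs))))
      atTop (𝓝 (K * g tstar)) := by
    have hx0 : 0 < (S * tstar / B) ^ (1 / (γb - γs)) := by positivity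
    have hGx0 : G ((S * tstar / B) ^ (1 / (γb - γs))) = K * g tstar := by
      rw [hGdef]
      dsimp only
      rw [← Real.rpow_mul (by positivity), one_div_mul_cancel hδ0, Real.rpow_one]
      congr 2
      field_simp
    have hl := (hlim (fun _ => (S * tstar / B) ^ (1 / (γb - γs))) (fun _ => hx0) _ hx0
      tendsto_const_nhds).mul_const (K * g tstar)
    rw [one_mul] at hl
    refine hl.congr' ?_
    filter_upwards [eventually_ne_atTop 0] with n hn
    have hN := hn0 hn
    have hc := hC n
    rw [hGx0, div_mul_cancel₀ _ (mul_pos hK0 hgstar).ne']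
    congr 2
    have hσn : σ n = ((n : ℝ) ^ ((1 : ℝ) / 2) * C n) ^ (1 / (γb - γs)) := by
      rw [hσ]
      dsimp only
      rw [show 1 / (2 * (γb - γs)) = 1 / 2 * (1 / (γb - γs)) by field_simp,
        Real.rpow_mul (by positivity), Real.mul_rpow hN.le (by positivity),
        ← Real.sqrt_eq_rpow (C n ^ 2), Real.sqrt_sq hc.le]
    rw [hσn, ← Real.div_rpow (by positivity) (by positivity), neg_div, Real.rpow_neg hN.le]
    congr 1
    field_simp
  have hinf : Tendsto (fun n : ℕ => A n * sInf ((fun h : ℝ => R n h) '' Set.Ioi (0 : ℝ)))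
      atTop (𝓝 (K * g tstar)) := by
    refine tendsto_order.2 ⟨fun c hc => ?_, fun c hc => ?_⟩
    · obtain ⟨c', hcc', hc'⟩ := exists_between hc
      filter_upwards [eventually_ne_atTop 0, eventually_forall_pos_le_of_tendsto_div
        (F := fun n x => A n * R n (x / σ n)) (mul_pos hK0 hgstar) hGmin hlim hesc hc']
        with n hn hle
      refine hcc'.trans_le ((div_le_iff₀' (hA0 hn)).1 (le_csInf (Set.nonempty_Ioi.image _) ?_))
      rintro _ ⟨h, hh, rfl⟩
      have := hle (h * σ n) (mul_pos hh (hσ0 hn))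
      rw [mul_div_cancel_right₀ _ (hσ0 hn).ne'] at this
      exact (div_le_iff₀' (hA0 hn)).2 this
    · filter_upwards [eventually_ne_atTop 0, hopt.eventually (gt_mem_nhds hc)] with n hn hlt
      have hN := hn0 hn
      have hc := hC n
      refine (mul_le_mul_of_nonneg_left (csInf_le ⟨0, ?_⟩ (Set.mem_image_of_mem _ ?_))
        (hA0 hn).le).trans_lt hlt
      · rintro _ ⟨h, hh, rfl⟩
        exact hRnonneg n h hh
      · rw [Set.mem_Ioi]
        positivity
  rw [hA, ← hInf, hK, hg] at hinf hopt
  exact ⟨hinf, hopt⟩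
end

section
/- Let γ_b > 0 > γ_s, r = γ_b/(γ_b − γ_s), S, B > 0, C_n > 0, and α ∈ (0,1). For each n let (Ω_n, 𝒜_n) be a measurable space, F an index set, {P_{n,f}}_{f∈F} probability measures on Ω_n, T : F → ℝ a target functional, and for each h > 0 let T̂_n(h) : Ω_n → ℝ be a random variable. For α' ∈ (0,1) define R_{FLCI,α',n}(h) = inf{χ ≥ 0 : P_{n,f}(|T̂_n(h) − T(f)| ≤ χ) ≥ 1 − α' for all f ∈ F}. Let h^{RMSE}_n = (n^{−1/2} S t_M/(C_n B))^{1/(γ_b−γ_s)} with t_M = √(1/r − 1), and let sd_n = n^{−1/2} (h^{RMSE}_n)^{γ_s} S. Assume: (a) for every α' in some neighborhood of α, the sequence R_{FLCI,α',n} satisfies the hypotheses of the minimax performance theorem with constants (S,B), C_n, γ_b, γ_s and criterion R̃(b,s) = s·cv_{1−α'}(b/s); (b) ŝe_n : Ω_n → (0,∞) are random variables with ŝe_n/sd_n → 1 in probability uniformly over f ∈ F, i.e., for every ε > 0, sup_{f∈F} P_{n,f}(|ŝe_n/sd_n − 1| > ε) → 0. Then lim_{n→∞} inf_{f∈F} P_{n,f}(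 |T̂_n(h^{RMSE}_n) − T(f)| ≤ cv_{1−α}(√(1/r − 1)) · ŝe_n ) = 1 − α. -/
open Filter Topology MeasureTheory ProbabilityTheory

/-- The standard normal CDF `Φ`. -/
noncomputable def Phi (x : ℝ) : ℝ := ((gaussianReal 0 1) (Set.Iic x)).toReal

/-- The critical value `cv_{1−α}(t)`: the `1−α` quantile of `|Z + t|` for `Z` standard
normal, i.e. `inf{χ ≥ 0 : Φ(χ − t) − Φ(−χ − t) ≥ 1 − α}`. -/
noncomputable def cv (α t : ℝ) : ℝ :=
  sInf {χ : ℝ | 0 ≤ χ ∧ 1 - α ≤ Phi (χ - t) - Phi (-χ - t)}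

/-- The hypotheses of the minimax performance theorem (Theorem 2.1 of the paper) for a
sequence of worst-case performance functions `R n` with criterion `R'` and constants
`(S, B)`: (a) `R n (h n)/R̃(h_n^{γb} C_n B, h_n^{γs} n^{−1/2} S) → 1` along regular
bandwidth sequences; (b) `C_n^{r−1} n^{r/2} R_n(h_n) → ∞` along bandwidth sequences with
`h_n (nC_n²)^{1/(2(γb−γs))} → ∞` or `→ 0`. -/
def MinimaxHyp (γb γs r : ℝ) (C : ℕ → ℝ) (R' : ℝ → ℝ → ℝ) (S B : ℝ)
    (R : ℕ → ℝ → ℝ) : Prop :=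
  (∀ n : ℕ, ∀ h : ℝ, 0 < h → 0 ≤ R n h) ∧
  (∀ h : ℕ → ℝ, (∀ n, 0 < h n) → RegularBW γb γs C h →
    Tendsto (fun n : ℕ => R n (h n) /
      R' ((h n) ^ γb * C n * B) ((h n) ^ γs * (n : ℝ) ^ (-(1 : ℝ) / 2) * S))
      atTop (𝓝 1)) ∧
  (∀ h : ℕ → ℝ, (∀ n, 0 < h n) →
    (Tendsto (scaledBW γb γs C h) atTop atTop ∨
      Tendsto (scaledBW γb γs C h) atTop (𝓝 0)) →
    Tendsto (fun n : ℕ => (C n) ^ (r - 1) * (n : ℝ) ^ (r / 2) * R n (h n)) atTop atTop)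

/-- The worst-case fixed-length CI half-length criterion
`R_{FLCI,α',n}(h) = inf{χ ≥ 0 : P_{n,f}(|T̂_n(h) − T(f)| ≤ χ) ≥ 1 − α' for all f}`. -/
noncomputable def RFLCI {Ω : ℕ → Type*} [∀ n, MeasurableSpace (Ω n)] {F : Type*}
    (P : (n : ℕ) → F → Measure (Ω n)) (T : F → ℝ) (That : (n : ℕ) → ℝ → Ω n → ℝ)
    (α' : ℝ) (n : ℕ) (h : ℝ) : ℝ :=
  sInf {χ : ℝ | 0 ≤ χ ∧
    ∀ f : F, 1 - α' ≤ ((P n f) {ω | |That n h ω - T f| ≤ χ}).toReal}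

theorem Phi_eq_cdf : Phi = fun x => cdf (gaussianReal 0 1) x := by
  ext x
  rw [cdf_eq_real]
  rfl

theorem continuous_Phi : Continuous Phi := by
  rw [Phi_eq_cdf, continuous_iff_continuousAt]
  intro x
  rw [(monotone_cdf _).continuousAt_iff_leftLim_eq_rightLim]
  have hatom : (cdf (gaussianReal 0 1)).measure {x} = 0 := by
    rw [measure_cdf]
    have := nullSingletonClass_gaussianReal (μ := 0) (v := 1) one_ne_zero
    exact measure_singleton x
  rw [StieltjesFunction.measure_singleton, ENNReal.ofReal_eq_zero] at hatom
  rw [StieltjesFunction.rightLim_eq]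
  exact le_antisymm ((monotone_cdf _).leftLim_le le_rfl) (by linarith)

/-- The distribution function `Φ(χ − t) − Φ(−χ − t)` of `|Z + t|` is continuous in `χ`. -/
theorem continuous_Phi_sub (t : ℝ) : Continuous fun χ => Phi (χ - t) - Phi (-χ - t) := by
  have := continuous_Phi
  fun_prop

theorem tendsto_Phi_sub (t : ℝ) :
    Tendsto (fun χ => Phi (χ - t) - Phi (-χ - t)) atTop (𝓝 1) := by
  rw [← sub_zero (1 : ℝ), Phi_eq_cdf]
  exact ((tendsto_cdf_atTop _).comp (tendsto_atTop_add_const_right _ (-t) tendsto_id)).sub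
    ((tendsto_cdf_atBot _).comp (tendsto_atBot_add_const_right _ (-t) tendsto_neg_atTop_atBot))

theorem cv_mem {a : ℝ} (ha : 0 < a) (t : ℝ) :
    0 ≤ cv a t ∧ 1 - a ≤ Phi (cv a t - t) - Phi (-cv a t - t) := by
  refine IsClosed.csInf_mem (s := {χ : ℝ | 0 ≤ χ ∧ 1 - a ≤ Phi (χ - t) - Phi (-χ - t)})
    ((isClosed_le continuous_const continuous_id).inter
      (isClosed_le continuous_const (continuous_Phi_sub t))) ?_ ⟨0, fun χ h => h.1⟩
  have h := (tendsto_Phi_sub t).eventually (lt_mem_nhds (show 1 - a < 1 by linarith))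
  obtain ⟨χ, h₁, h₂⟩ := (h.and (eventually_ge_atTop 0)).exists
  exact ⟨χ, h₂, h₁.le⟩

theorem cv_pos {a : ℝ} (ha : 0 < a) (ha' : a < 1) (t : ℝ) : 0 < cv a t := by
  obtain ⟨h₀, h₁⟩ := cv_mem ha t
  refine h₀.lt_of_ne fun h => ?_
  rw [← h] at h₁
  simp only [neg_zero, sub_self] at h₁
  linarith

theorem cv_lt_cv {a b : ℝ} (ha : 0 < a) (hab : a < b) (hb : b < 1) (t : ℝ) :
    cv b t < cv a t := by
  have hpos := cv_pos ha (hab.trans hb) t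
  have hG := (continuous_Phi_sub t).continuousAt.eventually
    (lt_mem_nhds (show 1 - b < _ by linarith [(cv_mem ha t).2]))
  have hG' : ∀ᶠ χ in 𝓝[<] cv a t, 1 - b < Phi (χ - t) - Phi (-χ - t) :=
    hG.filter_mono nhdsWithin_le_nhds
  have hI : ∀ᶠ χ in 𝓝[<] cv a t, χ ∈ Set.Ioo 0 (cv a t) := Ioo_mem_nhdsLT hpos
  obtain ⟨χ, h₁, h₂⟩ := (hG'.and hI).exists
  have hle : cv b t ≤ χ := csInf_le ⟨0, fun _ h => h.1⟩ ⟨h₂.1.le, h₁.le⟩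
  exact hle.trans_lt h₂.2

section Coverage

variable {Ω : ℕ → Type*} [∀ n, MeasurableSpace (Ω n)] {F : Type*}
  {P : (n : ℕ) → F → Measure (Ω n)} {T : F → ℝ} {That : (n : ℕ) → ℝ → Ω n → ℝ}
  {a h x : ℝ} {n : ℕ}

theorem le_coverage_of_RFLCI_lt [∀ f, IsProbabilityMeasure (P n f)]
    (hpos : 0 < RFLCI P T That a n h) (hx : RFLCI P T That a n h < x) (f : F) :
    1 - a ≤ (P n f).real {ω | |That n h ω - T f| ≤ x} := by
  have hne : {χ : ℝ | 0 ≤ χ ∧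
      ∀ f : F, 1 - a ≤ ((P n f) {ω | |That n h ω - T f| ≤ χ}).toReal}.Nonempty := by
    by_contra hne
    rw [Set.not_nonempty_iff_eq_empty] at hne
    rw [RFLCI, hne, Real.sInf_empty] at hpos
    exact hpos.false
  obtain ⟨χ, hχ, hχx⟩ := exists_lt_of_csInf_lt hne hx
  exact (hχ.2 f).trans (measureReal_mono fun ω (hω : _ ≤ χ) => hω.trans hχx.le)

theorem exists_coverage_lt_of_lt_RFLCI (hx₀ : 0 ≤ x) (hx : x < RFLCI P T That a n h) :
    ∃ f, (P n f).real {ω | |That n h ω - T f| ≤ x} < 1 - a := by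
  by_contra! hcon
  exact hx.not_ge (csInf_le ⟨0, fun _ h => h.1⟩ ⟨hx₀, hcon⟩)

end Coverage

/-- If `Y ≤ Z` off the event `η < V`, the level `Y` can be replaced by `Z` up to the probability
of that event. -/
theorem measureReal_setOf_le_le_add {Ω : Type*} [MeasurableSpace Ω] (μ : Measure Ω)
    [IsFiniteMeasure μ] (X Y Z V : Ω → ℝ) {η : ℝ} (h : ∀ ω, V ω ≤ η → Y ω ≤ Z ω) :
    μ.real {ω | X ω ≤ Y ω} ≤ μ.real {ω | X ω ≤ Z ω} + μ.real {ω | η < V ω} := by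
  refine (measureReal_mono fun ω hω => ?_).trans (measureReal_union_le _ _)
  by_cases hV : V ω ≤ η
  · exact Or.inl (le_trans hω (h ω hV))
  · exact Or.inr (not_le.mp hV)

theorem rmse_bandwidth_scaled {d k c y : ℝ} (hd : 0 < d) (hk : 0 < k) (hc : 0 < c) (hy : 0 < y) :
    (y ^ (-(1 : ℝ) / 2) * k / c) ^ (1 / d) * (y * c ^ 2) ^ (1 / (2 * d)) = k ^ (1 / d) := by
  have hy' : 0 < y ^ (-(1 : ℝ) / 2) := Real.rpow_pos_of_pos hy _
  have hsq : (y * c ^ 2) ^ (1 / (2 * d)) = (y ^ ((1 : ℝ) / 2) * c) ^ (1 / d) := by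
    have : y * c ^ 2 = (y ^ ((1 : ℝ) / 2) * c) ^ (2 : ℝ) := by
      rw [Real.mul_rpow (by positivity) hc.le, ← Real.rpow_mul hy.le]
      norm_num
    rw [this, ← Real.rpow_mul (by positivity)]
    congr 1
    field_simp
  rw [hsq, ← Real.mul_rpow (by positivity) (by positivity)]
  congr 1
  have : y ^ (-(1 : ℝ) / 2) * y ^ ((1 : ℝ) / 2) = 1 := by
    rw [← Real.rpow_add hy]
    norm_num
  generalize y ^ (-(1 : ℝ) / 2) = u at *
  field_simp
  linear_combination this

/-- coverage statement of Theorem 2.2 of the paper: the fixed-length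
confidence interval centered at the estimator with the RMSE-optimal bandwidth
`h^{RMSE}_n = (n^{−1/2} S t_M/(C_n B))^{1/(γb−γs)}`, `t_M = √(1/r−1)`, using the adjusted
critical value `cv_{1−α}(√(1/r−1))` and a uniformly consistent standard error, is
asymptotically honest with exact uniform coverage `1−α`: the infimum over `f` of the
coverage probability converges to `1 − α`. -/
theorem stmt4 (γb γs r : ℝ) (hγb : 0 < γb) (hγs : γs < 0)
    (hr : r = γb / (γb - γs))
    (S B : ℝ) (hS : 0 < S) (hB : 0 < B)
    (C : ℕ → ℝ) (hC : ∀ n, 0 < C n)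
    (α : ℝ) (hα : α ∈ Set.Ioo (0 : ℝ) 1)
    {Ω : ℕ → Type*} [∀ n, MeasurableSpace (Ω n)]
    {F : Type*} [Nonempty F]
    (P : (n : ℕ) → F → Measure (Ω n)) (hP : ∀ n f, IsProbabilityMeasure (P n f))
    (T : F → ℝ) (That : (n : ℕ) → ℝ → Ω n → ℝ)
    -- hypothesis (a): the FLCI criterion satisfies the minimax performance theorem
    -- hypotheses with criterion `R̃(b,s) = s·cv_{1−α'}(b/s)` for all `α'` near `α`,
    -- including the existence of a unique positive minimizer of `t ↦ t^{r−1} cv_{1−α'}(t)`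
    (ha : ∃ ε > (0 : ℝ), ∀ α' : ℝ, |α' - α| < ε →
      MinimaxHyp γb γs r C (fun b s => s * cv α' (b / s)) S B (RFLCI P T That α') ∧
      ∃ tF : ℝ, 0 < tF ∧ ∀ t : ℝ, 0 < t → t ≠ tF →
        tF ^ (r - 1) * cv α' tF < t ^ (r - 1) * cv α' t)
    (se : (n : ℕ) → Ω n → ℝ) (hse : ∀ n ω, 0 < se n ω)
    -- hypothesis (b): `ŝe_n/sd_n → 1` in probability uniformly over `f ∈ F`, where
    -- `sd_n = n^{−1/2} (h^{RMSE}_n)^{γs} S`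
    (hseconv : ∀ ε > (0 : ℝ), ∀ δ > (0 : ℝ), ∀ᶠ n in atTop, ∀ f : F,
      ((P n f) {ω | ε < |se n ω /
        ((n : ℝ) ^ (-(1 : ℝ) / 2) *
          (((n : ℝ) ^ (-(1 : ℝ) / 2) * S * Real.sqrt (1 / r - 1) /
            (C n * B)) ^ (1 / (γb - γs))) ^ γs * S) - 1|}).toReal ≤ δ) :
    Tendsto (fun n : ℕ => ⨅ f : F,
        ((P n f) {ω | |That n (((n : ℝ) ^ (-(1 : ℝ) / 2) * S * Real.sqrt (1 / r - 1) /
            (C n * B)) ^ (1 / (γb - γs))) ω - T f|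
          ≤ cv α (Real.sqrt (1 / r - 1)) * se n ω}).toReal)
      atTop (𝓝 (1 - α)) := by
  have hd : 0 < γb - γs := by linarith
  have ht : 0 < Real.sqrt (1 / r - 1) := by
    rw [Real.sqrt_pos, hr, one_div_div, sub_pos, one_lt_div hγb]
    linarith
  set t := Real.sqrt (1 / r - 1) with ht_def
  set h : ℕ → ℝ := fun n => ((n : ℝ) ^ (-(1 : ℝ) / 2) * S * t / (C n * B)) ^ (1 / (γb - γs))
    with h_def
  set sd : ℕ → ℝ := fun n => (n : ℝ) ^ (-(1 : ℝ) / 2) * h n ^ γs * S with sd_def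
  have hn : ∀ᶠ n : ℕ in atTop, 0 < n := eventually_gt_atTop 0
  have h_pos : ∀ n : ℕ, 0 < n → 0 < h n := fun n hn => by
    have := hC n
    positivity
  have sd_pos : ∀ n : ℕ, 0 < n → 0 < sd n := fun n hn => by
    have := h_pos n hn
    positivity
  have h_pow : ∀ n : ℕ, 0 < n →
      h n ^ γb * C n * B / (h n ^ γs * (n : ℝ) ^ (-(1 : ℝ) / 2) * S) = t := fun n hn => by
    have hn' : (0 : ℝ) < n := by exact_mod_cast hn
    have hCn := hC n
    have hh := h_pos n hn
    have hy : (0 : ℝ) < (n : ℝ) ^ (-(1 : ℝ) / 2) := by positivity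
    have key : h n ^ (γb - γs) = (n : ℝ) ^ (-(1 : ℝ) / 2) * S * t / (C n * B) := by
      simp only [h_def]
      rw [← Real.rpow_mul (by positivity), one_div_mul_cancel hd.ne', Real.rpow_one]
    rw [Real.rpow_sub hh] at key
    have hγ : 0 < h n ^ γs := by positivity
    field_simp at key ⊢
    linear_combination key
  have ratio : ∀ a : ℝ, MinimaxHyp γb γs r C (fun b s => s * cv a (b / s)) S B
      (RFLCI P T That a) →
      Tendsto (fun n => RFLCI P T That a n (h n) / (sd n * cv a t)) atTop (𝓝 1) := by
    intro a hyp
    set h' : ℕ → ℝ := fun n => if n = 0 then 1 else h n with h'_def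
    have h'_eq : ∀ n : ℕ, 0 < n → h' n = h n := fun n hn => if_neg hn.ne'
    have h'_pos : ∀ n, 0 < h' n := by
      intro n
      rcases n.eq_zero_or_pos with rfl | hn
      · simp [h'_def]
      · rw [h'_eq n hn]
        exact h_pos n hn
    have hreg : RegularBW γb γs C h' := by
      refine ⟨(S * t / B) ^ (1 / (γb - γs)), (S * t / B) ^ (1 / (γb - γs)), by positivity, ?_⟩
      filter_upwards [hn] with n hn
      have hn' : (0 : ℝ) < n := by exact_mod_cast hn
      have : scaledBW γb γs C h' n = (S * t / B) ^ (1 / (γb - γs)) := by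
        rw [scaledBW, h'_eq n hn, ← rmse_bandwidth_scaled hd (k := S * t / B) (by positivity)
          (hC n) hn']
        have hCn := hC n
        have e : (n : ℝ) ^ (-(1 : ℝ) / 2) * (S * t / B) / C n =
            (n : ℝ) ^ (-(1 : ℝ) / 2) * S * t / (C n * B) := by
          generalize (n : ℝ) ^ (-(1 : ℝ) / 2) = u
          field_simp
        rw [e]
      exact ⟨this.ge, this.le⟩
    refine (hyp.2.1 h' h'_pos hreg).congr' ?_
    filter_upwards [hn] with n hn
    rw [h'_eq n hn, h_pow n hn, mul_comm (h n ^ γs)]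
  obtain ⟨ε, hε, hyp⟩ := ha
  obtain ⟨hα₀, hα₁⟩ := hα
  have hq := cv_pos hα₀ hα₁ t
  have := hP
  change Tendsto (fun n : ℕ => ⨅ f : F,
    (P n f).real {ω | |That n (h n) ω - T f| ≤ cv α t * se n ω}) atTop (𝓝 (1 - α))
  rw [tendsto_order]
  constructor
  · intro a ha
    obtain ⟨α₁, h₁, h₂⟩ := exists_between
      (show α < min (α + ε) (min 1 (1 - a)) by
        refine lt_min ?_ (lt_min hα₁ ?_) <;> linarith)
    obtain ⟨h₂, h₃, h₄⟩ : α₁ < α + ε ∧ α₁ < 1 ∧ α₁ < 1 - a := by simpa using h₂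
    have hq₁ := cv_pos (hα₀.trans h₁) h₃ t
    obtain ⟨x, hx₁, hx₂⟩ := exists_between (cv_lt_cv hα₀ h₁ h₃ t)
    have hlim := ratio α₁ (hyp α₁ (by rw [abs_lt]; constructor <;> linarith)).1
    filter_upwards [hn, hlim.eventually (lt_mem_nhds one_pos),
      hlim.eventually (gt_mem_nhds ((one_lt_div hq₁).2 hx₁)),
      hseconv (1 - x / cv α t) (sub_pos.2 ((div_lt_one hq).2 hx₂)) ((1 - α₁ - a) / 2)
        (by linarith)] with n hn hR₀ hR hbad
    have hs := sd_pos n hn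
    have hR₀' := (div_pos_iff_of_pos_right (by positivity)).1 hR₀
    have hR' : RFLCI P T That α₁ n (h n) < sd n * x := by
      rw [div_lt_div_iff₀ (by positivity) hq₁] at hR
      nlinarith
    refine lt_of_lt_of_le (show a < 1 - α₁ - (1 - α₁ - a) / 2 by linarith) (le_ciInf fun f => ?_)
    have h₅ := le_coverage_of_RFLCI_lt hR₀' hR' f
    have h₆ := measureReal_setOf_le_le_add (P n f) (fun ω => |That n (h n) ω - T f|)
      (fun _ => sd n * x) (fun ω => cv α t * se n ω) (fun ω => |se n ω / sd n - 1|)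
      (η := 1 - x / cv α t) (fun ω hω => by
        have h₇ : x / cv α t ≤ se n ω / sd n := by linarith [(abs_le.1 hω).1]
        rw [div_le_div_iff₀ hq hs] at h₇
        linarith)
    have h₈ := hbad f
    change (P n f).real {ω | 1 - x / cv α t < |se n ω / sd n - 1|} ≤ _ at h₈
    linarith
  · intro a ha
    obtain ⟨α₂, h₁, h₂⟩ := exists_between
      (show max (α - ε) (max 0 (1 - a)) < α by
        refine max_lt ?_ (max_lt hα₀ ?_) <;> linarith)
    obtain ⟨h₁, h₃, h₄⟩ : α - ε < α₂ ∧ 0 < α₂ ∧ 1 - a < α₂ := by simpa using h₁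
    have hq₂ := cv_pos h₃ (h₂.trans hα₁) t
    obtain ⟨x, hx₁, hx₂⟩ := exists_between (cv_lt_cv h₃ h₂ hα₁ t)
    have hlim := ratio α₂ (hyp α₂ (by rw [abs_lt]; constructor <;> linarith)).1
    filter_upwards [hn, hlim.eventually (lt_mem_nhds ((div_lt_one hq₂).2 hx₂)),
      hseconv (x / cv α t - 1) (sub_pos.2 ((one_lt_div hq).2 hx₁)) ((a - (1 - α₂)) / 2)
        (by linarith)] with n hn hR hbad
    have hs := sd_pos n hn
    have hR' : sd n * x < RFLCI P T That α₂ n (h n) := by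
      rw [div_lt_div_iff₀ hq₂ (by positivity)] at hR
      nlinarith
    obtain ⟨f, h₅⟩ := exists_coverage_lt_of_lt_RFLCI
      (mul_nonneg hs.le (hq.trans hx₁).le) hR'
    have h₆ := measureReal_setOf_le_le_add (P n f) (fun ω => |That n (h n) ω - T f|)
      (fun ω => cv α t * se n ω) (fun _ => sd n * x) (fun ω => |se n ω / sd n - 1|)
      (η := x / cv α t - 1) (fun ω hω => by
        have h₇ : se n ω / sd n ≤ x / cv α t := by linarith [(abs_le.1 hω).2]
        rw [div_le_div_iff₀ hs hq] at h₇
        linarith)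
    have h₈ := hbad f
    change (P n f).real {ω | x / cv α t - 1 < |se n ω / sd n - 1|} ≤ _ at h₈
    refine (ciInf_le ⟨0, ?_⟩ f).trans_lt (show _ < a by linarith)
    rintro _ ⟨g, rfl⟩
    exact measureReal_nonneg
end

section
/- Let γ_b > 0 > γ_s, r = γ_b/(γ_b − γ_s), S, B > 0, C_n > 0 a sequence of positive reals, and α ∈ (0,1). Suppose a sequence of functions R_n^{FLCI} : (0,∞) → [0,∞) satisfies the hypotheses of the minimax performance theorem with constants (S,B), C_n, γ_b, γ_s and criterion R̃_{FLCI}(b,s) = s·cv_{1−α}(b/s), where t_F > 0 is the unique minimizer of t ↦ t^{r−1} cv_{1−α}(t) over (0,∞). Let t_M = √(1/r − 1) and h^{RMSE}_n = (n^{−1/2} S t_M/(C_n B))^{1/(γ_b−γ_s)}. Then lim_{n→∞} [inf_{h>0} R_n^{FLCI}(h)] / R_n^{FLCI}(h^{RMSE}_n) = [t_F^{r−1} cv_{1−α}(t_F)] / [t_M^{r−1} cv_{1−α}(t_M)]; in particular this asymptotic efficiency of the fixed-length CI centered at the RMSE-optimal bandwidth relative to the CI-length-optimal bandwidth depends only on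 r and α. -/
open Filter Topology MeasureTheory ProbabilityTheory

/-- If `Q n (u n) / G (u n) → 1` along sequences bounded away from `0` and `∞` and
`Q n (u n) → ∞` along sequences tending to `0` or `∞`, then a positive lower bound of `G` is
an asymptotic lower bound of `Q n`, uniformly over `(0, ∞)`. -/
theorem eventually_forall_lt_of_tendsto_div {Q : ℕ → ℝ → ℝ} {G : ℝ → ℝ} {m q : ℝ}
    (hm : 0 < m) (hG : ∀ u, 0 < u → m ≤ G u)
    (hreg : ∀ u : ℕ → ℝ, (∀ n, 0 < u n) → (∃ c₁ c₂ : ℝ, 0 < c₁ ∧ ∀ n, c₁ ≤ u n ∧ u n ≤ c₂) →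
      Tendsto (fun n => Q n (u n) / G (u n)) atTop (𝓝 1))
    (hirr : ∀ u : ℕ → ℝ, (∀ n, 0 < u n) → (Tendsto u atTop atTop ∨ Tendsto u atTop (𝓝 0)) →
      Tendsto (fun n => Q n (u n)) atTop atTop)
    (hq : q < m) : ∀ᶠ n in atTop, ∀ u, 0 < u → q < Q n u := by
  classical
  have key : ∀ u : ℕ → ℝ, (∀ n, 0 < u n) → ∀ᶠ n in atTop, q < Q n (u n) := by
    intro u hu
    have bdd : ∀ c₁ c₂ : ℝ, 0 < c₁ → c₁ ≤ c₂ →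
        ∀ᶠ n in atTop, c₁ ≤ u n → u n ≤ c₂ → q < Q n (u n) := by
      intro c₁ c₂ hc₁ hc
      have hb : ∀ n, c₁ ≤ max c₁ (min (u n) c₂) ∧ max c₁ (min (u n) c₂) ≤ c₂ := fun n =>
        ⟨le_max_left _ _, max_le hc (min_le_right _ _)⟩
      have hlim := hreg (fun n => max c₁ (min (u n) c₂)) (fun n => hc₁.trans_le (hb n).1)
        ⟨c₁, c₂, hc₁, hb⟩
      have hlt : q / m < 1 := (div_lt_one hm).2 hq
      have hlt' : max (q / m) 0 < 1 := max_lt hlt one_pos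
      filter_upwards [hlim.eventually_const_lt hlt'] with n hn h1 h2
      rw [min_eq_left h2, max_eq_right h1] at hn
      have hGn := hG _ (hu n)
      rw [lt_div_iff₀ (hm.trans_le hGn)] at hn
      calc q = q / m * m := by field_simp
        _ ≤ max (q / m) 0 * m := by gcongr; exact le_max_left _ _
        _ ≤ max (q / m) 0 * G (u n) := by gcongr
        _ < _ := hn
    have large : ∀ᶠ n in atTop, 1 ≤ u n → q < Q n (u n) := by
      have hlim := hirr (fun n => if 1 ≤ u n ∧ Q n (u n) ≤ q then u n else (n : ℝ) + 1)
        (fun n => by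
          split_ifs
          · exact hu n
          · positivity)
        (Or.inl (by
          rw [tendsto_atTop]
          intro K
          filter_upwards [bdd 1 (max 1 K) one_pos (le_max_left _ _),
            tendsto_natCast_atTop_atTop.eventually_ge_atTop K] with n hn hK
          split_ifs with h
          · by_contra! hlt
            exact absurd (hn h.1 (hlt.le.trans (le_max_right _ _))) (not_lt.2 h.2)
          · linarith))
      filter_upwards [hlim.eventually_gt_atTop q] with n hn h1
      by_contra! h2
      rw [if_pos ⟨h1, h2⟩] at hn
      exact absurd hn (not_lt.2 h2)
    have small : ∀ᶠ n in atTop, u n ≤ 1 → q < Q n (u n) := by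
      have hlim := hirr (fun n => if u n ≤ 1 ∧ Q n (u n) ≤ q then u n else 1 / ((n : ℝ) + 1))
        (fun n => by
          split_ifs
          · exact hu n
          · positivity)
        (Or.inr (by
          rw [Metric.tendsto_nhds]
          intro ε hε
          filter_upwards [bdd (min 1 ε) 1 (lt_min one_pos hε) (min_le_left _ _),
            tendsto_one_div_add_atTop_nhds_zero_nat.eventually_lt_const hε] with n hn hK
          split_ifs with h
          · rw [Real.dist_eq, sub_zero, abs_of_pos (hu n)]
            by_contra! hlt
            exact absurd (hn ((min_le_right _ _).trans hlt) h.1) (not_lt.2 h.2)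
          · rwa [Real.dist_eq, sub_zero, abs_of_pos (by positivity)]))
      filter_upwards [hlim.eventually_gt_atTop q] with n hn h1
      by_contra! h2
      rw [if_pos ⟨h1, h2⟩] at hn
      exact absurd hn (not_lt.2 h2)
    filter_upwards [large, small] with n h1 h2
    exact (le_total 1 (u n)).elim h1 h2
  let u : ℕ → ℝ := fun n => if h : ∃ v, 0 < v ∧ Q n v ≤ q then h.choose else 1
  have hu : ∀ n, 0 < u n := by
    intro n
    dsimp only [u]
    split_ifs with h
    · exact h.choose_spec.1
    · exact one_pos
  filter_upwards [key u hu] with n hn v hv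
  by_contra! hle
  have h : ∃ v, 0 < v ∧ Q n v ≤ q := ⟨v, hv, hle⟩
  have hun : u n = h.choose := dif_pos h
  rw [hun] at hn
  exact absurd hn (not_lt.2 h.choose_spec.2)

theorem cv_nonneg (α t : ℝ) : 0 ≤ cv α t :=
  Real.sInf_nonneg fun _ h => h.1

/-- The bias-standard deviation ratio at `h = u (N c²)^{-1/(2(γb-γs))}` is `u^{γb-γs} B / S`. -/
theorem bias_sd_ratio_eq {γb γs S B N c u : ℝ} (hk : 0 < γb - γs)
    (hN : 0 < N) (hc : 0 < c) (hu : 0 < u) :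
    (u / (N * c ^ 2) ^ (1 / (2 * (γb - γs)))) ^ γb * c * B /
      ((u / (N * c ^ 2) ^ (1 / (2 * (γb - γs)))) ^ γs * N ^ (-(1 : ℝ) / 2) * S) =
      u ^ (γb - γs) * B / S := by
  obtain ⟨x, rfl⟩ : ∃ x, N = Real.exp x := ⟨_, (Real.exp_log hN).symm⟩
  obtain ⟨y, rfl⟩ : ∃ y, c = Real.exp y := ⟨_, (Real.exp_log hc).symm⟩
  obtain ⟨z, rfl⟩ : ∃ z, u = Real.exp z := ⟨_, (Real.exp_log hu).symm⟩
  rw [← Real.exp_nat_mul]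
  simp only [← Real.exp_mul, ← Real.exp_add, ← Real.exp_sub]
  rw [mul_div_mul_comm, ← Real.exp_sub, mul_div_assoc]
  congr 2
  have := hk.ne'
  field_simp
  push_cast
  ring

/-- The standard deviation at `h = u (N c²)^{-1/(2(γb-γs))}`, after rescaling. -/
theorem rescaled_sd_eq {γb γs S N c u : ℝ} (hk : 0 < γb - γs)
    (hN : 0 < N) (hc : 0 < c) (hu : 0 < u) :
    c ^ (γb / (γb - γs) - 1) * N ^ (γb / (γb - γs) / 2) *
      ((u / (N * c ^ 2) ^ (1 / (2 * (γb - γs)))) ^ γs * N ^ (-(1 : ℝ) / 2) * S) =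
      u ^ γs * S := by
  obtain ⟨x, rfl⟩ : ∃ x, N = Real.exp x := ⟨_, (Real.exp_log hN).symm⟩
  obtain ⟨y, rfl⟩ : ∃ y, c = Real.exp y := ⟨_, (Real.exp_log hc).symm⟩
  obtain ⟨z, rfl⟩ : ∃ z, u = Real.exp z := ⟨_, (Real.exp_log hu).symm⟩
  rw [← Real.exp_nat_mul]
  simp only [← Real.exp_mul, ← Real.exp_add, ← Real.exp_sub]
  rw [← mul_assoc, ← Real.exp_add]
  congr 2
  have := hk.ne'
  field_simp
  push_cast
  ring

theorem rpow_eq_mul_ratio_rpow {γb γs S B u : ℝ} (hk : 0 < γb - γs)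
    (hS : 0 < S) (hB : 0 < B) (hu : 0 < u) :
    u ^ γs = (S / B) ^ (γb / (γb - γs) - 1) *
      (u ^ (γb - γs) * B / S) ^ (γb / (γb - γs) - 1) := by
  rw [← Real.mul_rpow (by positivity) (by positivity)]
  have h : S / B * (u ^ (γb - γs) * B / S) = u ^ (γb - γs) := by field_simp
  rw [h, ← Real.rpow_mul hu.le]
  congr 1
  have := hk.ne'
  field_simp
  ring

/-- The bandwidth with bias-standard deviation ratio `t`. -/
theorem bandwidth_eq_div {k S B N c t : ℝ} (hk : 0 < k) (hS : 0 < S) (hB : 0 < B)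
    (hN : 0 < N) (hc : 0 < c) (ht : 0 < t) :
    (N ^ (-(1 : ℝ) / 2) * S * t / (c * B)) ^ (1 / k) =
      (t * S / B) ^ (1 / k) / (N * c ^ 2) ^ (1 / (2 * k)) := by
  have h : (N * c ^ 2) ^ (1 / (2 * k)) = (N ^ ((1 : ℝ) / 2) * c) ^ (1 / k) := by
    have hsq : N * c ^ 2 = (N ^ ((1 : ℝ) / 2) * c) ^ (2 : ℝ) := by
      rw [Real.mul_rpow (by positivity) hc.le, ← Real.rpow_mul hN.le]
      norm_num
    rw [hsq, ← Real.rpow_mul (by positivity)]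
    congr 1
    field_simp
  rw [h, ← Real.div_rpow (by positivity) (by positivity), neg_div, Real.rpow_neg hN.le]
  congr 1
  field_simp

/-- relative-efficiency statement of Theorem 2.2 of the paper, equation (6).
If the worst-case FLCI half-length functions `R_n^{FLCI}` satisfy the hypotheses of the
minimax performance theorem with criterion `R̃_{FLCI}(b,s) = s·cv_{1−α}(b/s)` and `t_F` is
the unique positive minimizer of `t ↦ t^{r−1} cv_{1−α}(t)`, then with
`t_M = √(1/r − 1)` and `h^{RMSE}_n = (n^{−1/2} S t_M/(C_n B))^{1/(γb−γs)}`, the ratio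
`inf_{h>0} R_n^{FLCI}(h) / R_n^{FLCI}(h^{RMSE}_n)` converges to
`t_F^{r−1} cv_{1−α}(t_F) / (t_M^{r−1} cv_{1−α}(t_M))`, which depends only on `r` and `α`. -/
theorem stmt5 (γb γs r : ℝ) (hγb : 0 < γb) (hγs : γs < 0)
    (hr : r = γb / (γb - γs))
    (S B : ℝ) (hS : 0 < S) (hB : 0 < B)
    (C : ℕ → ℝ) (hC : ∀ n, 0 < C n)
    (α : ℝ) (hα : α ∈ Set.Ioo (0 : ℝ) 1)
    (RFLCI : ℕ → ℝ → ℝ)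
    (hR : MinimaxHyp γb γs r C (fun b s => s * cv α (b / s)) S B RFLCI)
    (tF : ℝ) (htF : 0 < tF)
    (htFmin : ∀ t : ℝ, 0 < t → t ≠ tF →
      tF ^ (r - 1) * cv α tF < t ^ (r - 1) * cv α t) :
    Tendsto (fun n : ℕ =>
        sInf ((fun h : ℝ => RFLCI n h) '' Set.Ioi (0 : ℝ)) /
          RFLCI n (((n : ℝ) ^ (-(1 : ℝ) / 2) * S * Real.sqrt (1 / r - 1) /
            (C n * B)) ^ (1 / (γb - γs)))) atTop
      (𝓝 ((tF ^ (r - 1) * cv α tF) /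
        ((Real.sqrt (1 / r - 1)) ^ (r - 1) * cv α (Real.sqrt (1 / r - 1))))) := by
  subst hr
  obtain ⟨hR0, hRreg, hRirr⟩ := hR
  have hk : 0 < γb - γs := by linarith
  set tM := Real.sqrt (1 / (γb / (γb - γs)) - 1) with htM_def
  have htM : 0 < tM := by
    refine Real.sqrt_pos.2 (sub_pos.2 ?_)
    rw [one_div_div, lt_div_iff₀ hγb]
    linarith
  let a : ℕ → ℝ := fun n =>
    (C n) ^ (γb / (γb - γs) - 1) * (n : ℝ) ^ (γb / (γb - γs) / 2)
  let w : ℕ → ℝ := fun n => (max (n : ℝ) 1 * (C n) ^ 2) ^ (1 / (2 * (γb - γs)))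
  let G : ℝ → ℝ := fun u => u ^ γs * S * cv α (u ^ (γb - γs) * B / S)
  let g : ℝ → ℝ := fun t => t ^ (γb / (γb - γs) - 1) * cv α t
  let κ : ℝ := S * (S / B) ^ (γb / (γb - γs) - 1)
  have hκ : 0 < κ := by positivity
  have hw : ∀ n, 0 < w n := fun n => by have := hC n; positivity
  have ha : ∀ n : ℕ, 1 ≤ n → 0 < a n := fun n hn => by
    have := hC n
    have : (0 : ℝ) < n := by exact_mod_cast hn
    positivity
  have hmax : ∀ n : ℕ, 1 ≤ n → max (n : ℝ) 1 = n := fun n hn =>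
    max_eq_left (by exact_mod_cast hn)
  have hscaled : ∀ u : ℕ → ℝ, ∀ n : ℕ, 1 ≤ n →
      scaledBW γb γs C (fun n => u n / w n) n = u n := by
    intro u n hn
    have := hw n
    simp only [scaledBW, w, hmax n hn] at this ⊢
    exact div_mul_cancel₀ _ this.ne'
  have hGg : ∀ u, 0 < u → G u = κ * g (u ^ (γb - γs) * B / S) := by
    intro u hu
    simp only [G, κ, g]
    rw [rpow_eq_mul_ratio_rpow hk hS hB hu]
    ring
  have hreg : ∀ u : ℕ → ℝ, (∀ n, 0 < u n) →
      (∃ c₁ c₂ : ℝ, 0 < c₁ ∧ ∀ n, c₁ ≤ u n ∧ u n ≤ c₂) →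
      Tendsto (fun n => a n * RFLCI n (u n / w n) / G (u n)) atTop (𝓝 1) := by
    rintro u hu ⟨c₁, c₂, hc₁, hc⟩
    refine (hRreg (fun n => u n / w n) (fun n => div_pos (hu n) (hw n))
      ⟨c₁, c₂, hc₁, ?_⟩).congr' ?_
    · filter_upwards [eventually_ge_atTop 1] with n hn
      rw [hscaled u n hn]
      exact hc n
    · filter_upwards [eventually_ge_atTop 1] with n hn
      have hn' : (0 : ℝ) < n := by exact_mod_cast hn
      have han := ha n hn
      simp only [G, w, hmax n hn]
      rw [bias_sd_ratio_eq hk hn' (hC n) (hu n),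
        ← rescaled_sd_eq (S := S) hk hn' (hC n) (hu n), mul_assoc (_ * _) (_ * _ * S) (cv _ _)]
      exact (mul_div_mul_left _ _ han.ne').symm
  have hirr : ∀ u : ℕ → ℝ, (∀ n, 0 < u n) →
      (Tendsto u atTop atTop ∨ Tendsto u atTop (𝓝 0)) →
      Tendsto (fun n => a n * RFLCI n (u n / w n)) atTop atTop := by
    intro u hu h
    have he : u =ᶠ[atTop] scaledBW γb γs C (fun n => u n / w n) := by
      filter_upwards [eventually_ge_atTop 1] with n hn using (hscaled u n hn).symm
    exact hRirr (fun n => u n / w n) (fun n => div_pos (hu n) (hw n))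
      (h.imp (fun h => h.congr' he) (fun h => h.congr' he))
  have hratio : ∀ t, 0 < t →
      ((t * S / B) ^ (1 / (γb - γs))) ^ (γb - γs) * B / S = t := by
    intro t ht
    rw [← Real.rpow_mul (by positivity), one_div_mul_cancel hk.ne', Real.rpow_one]
    field_simp
  have hGpos : ∀ u, 0 < u → 0 < G u := by
    intro u hu
    refine lt_of_le_of_ne (mul_nonneg (by positivity) (cv_nonneg _ _)) fun h0 => ?_
    have h1 := hreg (fun _ => u) (fun _ => hu) ⟨u, u, hu, fun _ => ⟨le_rfl, le_rfl⟩⟩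
    simp only [← h0, div_zero] at h1
    exact zero_ne_one (tendsto_nhds_unique tendsto_const_nhds h1)
  have hconst : ∀ t, 0 < t → 0 < g t ∧ Tendsto
      (fun n => a n * RFLCI n ((t * S / B) ^ (1 / (γb - γs)) / w n)) atTop (𝓝 (κ * g t)) := by
    intro t ht
    have hu : 0 < (t * S / B) ^ (1 / (γb - γs)) := by positivity
    have hGt := hGg _ hu
    rw [hratio t ht] at hGt
    have hpos := hGpos _ hu
    have h1 := hreg (fun _ => (t * S / B) ^ (1 / (γb - γs))) (fun _ => hu)
      ⟨_, _, hu, fun _ => ⟨le_rfl, le_rfl⟩⟩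
    have h2 := h1.mul_const (G ((t * S / B) ^ (1 / (γb - γs))))
    simp only [div_mul_cancel₀ _ hpos.ne', one_mul] at h2
    rw [hGt] at h2 hpos
    exact ⟨pos_of_mul_pos_right hpos hκ.le, h2⟩
  have hGmin : ∀ u, 0 < u → κ * g tF ≤ G u := by
    intro u hu
    rw [hGg u hu]
    refine mul_le_mul_of_nonneg_left ?_ hκ.le
    rcases eq_or_ne (u ^ (γb - γs) * B / S) tF with h | h
    · rw [h]
    · exact (htFmin _ (by positivity) h).le
  have hinf : Tendsto (fun n => a n * sInf ((fun h : ℝ => RFLCI n h) '' Set.Ioi (0 : ℝ))) atTop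
      (𝓝 (κ * g tF)) := by
    rw [tendsto_order]
    constructor
    · intro q hq
      obtain ⟨q', hqq', hq'⟩ := exists_between hq
      filter_upwards [eventually_forall_lt_of_tendsto_div
        (Q := fun n u => a n * RFLCI n (u / w n)) (mul_pos hκ (hconst tF htF).1) hGmin
        hreg hirr hq', eventually_ge_atTop 1] with n hn h1
      have han := ha n h1
      refine hqq'.trans_le ?_
      rw [← div_le_iff₀' han]
      refine le_csInf (Set.nonempty_Ioi.image _) ?_
      rintro _ ⟨h, hh, rfl⟩
      have := hn (h * w n) (mul_pos hh (hw n))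
      rw [mul_div_cancel_right₀ _ (hw n).ne'] at this
      rw [div_le_iff₀' han]
      exact this.le
    · intro q hq
      filter_upwards [(hconst tF htF).2.eventually_lt_const hq, eventually_ge_atTop 1] with n hn h1
      refine lt_of_le_of_lt (mul_le_mul_of_nonneg_left (csInf_le ⟨0, ?_⟩ ?_) (ha n h1).le) hn
      · rintro _ ⟨h, hh, rfl⟩
        exact hR0 n h hh
      · exact ⟨_, div_pos (by positivity) (hw n), rfl⟩
  obtain ⟨hgM, hlimM⟩ := hconst tM htM
  have hdiv := hinf.div hlimM (mul_pos hκ hgM).ne'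
  rw [mul_div_mul_left _ _ hκ.ne'] at hdiv
  refine hdiv.congr' ?_
  filter_upwards [eventually_ge_atTop 1] with n hn
  have hn' : (0 : ℝ) < n := by exact_mod_cast hn
  simp only [Pi.div_apply]
  rw [bandwidth_eq_div hk hS hB hn' (hC n) htM, mul_div_mul_left _ _ (ha n hn).ne']
  simp only [w, hmax n hn]
end

section
/- Let p ≥ 1 be an integer, let x_1, …, x_n ≥ 0 and weights w_1, …, w_n ∈ ℝ satisfy Σ_{i=1}^n w_i = 1 and Σ_{i=1}^n w_i x_i^j = 0 for j = 1, …, p−1, and let f : ℝ → ℝ be p times continuously differentiable on [0,∞). Then Σ_{i=1}^n w_i f(x_i) − f(0) = ∫_0^∞ f^{(p)}(s) · W_p(s) ds, where W_p(s) = (1/(p−1)!) Σ_{i : x_i ≥ s} w_i (x_i − s)^{p−1}. -/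
open MeasureTheory

/-- The weight function
`W_p(s) = (1/(p−1)!) Σ_{i : x_i ≥ s} w_i (x_i − s)^{p−1}` determined by the estimator
weights `w_i` and design points `x_i`. -/
noncomputable def Wp (p n : ℕ) (x w : ℕ → ℝ) (s : ℝ) : ℝ :=
  (1 / ((p - 1).factorial : ℝ)) *
    ∑ i ∈ (Finset.range n).filter (fun i => s ≤ x i), w i * (x i - s) ^ (p - 1)

/-- Taylor's theorem with integral remainder at the left endpoint of a half-line. -/
theorem sub_taylorWithinEval_Ici_eq_integral {f : ℝ → ℝ} {m : ℕ} {a b : ℝ} (hab : a ≤ b)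
    (hf : ContDiffOn ℝ (m + 1 : ℕ) f (Set.Ici a)) :
    f b - taylorWithinEval f m (Set.Ici a) a b =
      ∫ t in a..b,
        ((m.factorial : ℝ)⁻¹ * (b - t) ^ m) * iteratedDerivWithin (m + 1) f (Set.Ici a) t := by
  have hu : UniqueDiffOn ℝ (Set.Ici a) := uniqueDiffOn_Ici a
  have hsub : Set.Icc a b ⊆ Set.Ici a := Set.Icc_subset_Ici_self
  have hf' : ContDiffOn ℝ m f (Set.Ici a) := hf.of_le (by norm_cast; omega)
  rw [intervalIntegral.integral_eq_sub_of_hasDerivAt_of_le hab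
    (f := fun t => taylorWithinEval f m (Set.Ici a) t b), taylorWithinEval_self]
  · exact (continuousOn_taylorWithinEval hu hf').mono hsub
  · intro t ht
    have hmem : Set.Ici a ∈ nhds t := Ici_mem_nhds ht.1
    exact (hasDerivWithinAt_taylorWithinEval hu self_mem_nhdsWithin ht.1.le subset_rfl hf'
      (hf.differentiableOn_iteratedDerivWithin (by norm_cast; omega) hu t ht.1.le)).hasDerivAt
        hmem
  · have hD := (hf.continuousOn_iteratedDerivWithin le_rfl hu).mono hsub
    rw [← Set.uIcc_of_le hab] at hD
    exact ContinuousOn.intervalIntegrable (by fun_prop)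

/-- A weighted sum reproducing the polynomials of degree at most `m` evaluates every Taylor
polynomial of degree `m` at its centre `0`. -/
theorem sum_mul_taylorWithinEval_zero {ι : Type*} (u : Finset ι) (m : ℕ) (x w : ι → ℝ)
    (hw : ∑ i ∈ u, w i = 1)
    (hwj : ∀ j : ℕ, 1 ≤ j → j ≤ m → ∑ i ∈ u, w i * x i ^ j = 0) (f : ℝ → ℝ) (s : Set ℝ) :
    ∑ i ∈ u, w i * taylorWithinEval f m s 0 (x i) = f 0 := by
  simp only [taylor_within_apply, sub_zero, smul_eq_mul, Finset.mul_sum]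
  rw [Finset.sum_comm, Finset.sum_eq_single 0]
  · simp [← Finset.sum_mul, hw]
  · intro j hj hj0
    rw [Finset.mem_range] at hj
    calc ∑ i ∈ u, w i * ((j.factorial : ℝ)⁻¹ * x i ^ j * iteratedDerivWithin j f s 0)
        = (∑ i ∈ u, w i * x i ^ j) * ((j.factorial : ℝ)⁻¹ * iteratedDerivWithin j f s 0) := by
          rw [Finset.sum_mul]
          exact Finset.sum_congr rfl fun i _ => by ring
      _ = 0 := by rw [hwj j (by omega) (by omega), zero_mul]
  · simp

/-- the integration-by-parts (Taylor remainder) representation of the bias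
of a linear estimator `Σ w_i f(x_i)` of `f(0)` in the boundary case.  If the weights
reproduce polynomials of degree up to `p−1` and `f` is `p` times continuously
differentiable on `[0,∞)`, then
`Σ w_i f(x_i) − f(0) = ∫_0^∞ f^{(p)}(s) W_p(s) ds`. -/
theorem stmt17 (p : ℕ) (hp : 1 ≤ p) (n : ℕ) (x w : ℕ → ℝ) (hx : ∀ i, 0 ≤ x i)
    (hw1 : ∑ i ∈ Finset.range n, w i = 1)
    (hwj : ∀ j : ℕ, 1 ≤ j → j ≤ p - 1 → ∑ i ∈ Finset.range n, w i * x i ^ j = 0)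
    (f : ℝ → ℝ) (hf : ContDiffOn ℝ p f (Set.Ici 0)) :
    ∑ i ∈ Finset.range n, w i * f (x i) - f 0
      = ∫ s in Set.Ioi (0 : ℝ),
          iteratedDerivWithin p f (Set.Ici 0) s * Wp p n x w s := by
  obtain ⟨m, rfl⟩ : ∃ m, p = m + 1 := ⟨p - 1, by omega⟩
  simp only [Nat.add_sub_cancel] at hwj
  set D := iteratedDerivWithin (m + 1) f (Set.Ici 0)
  have hDc : ContinuousOn D (Set.Ici 0) :=
    hf.continuousOn_iteratedDerivWithin le_rfl (uniqueDiffOn_Ici 0)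
  let k : ℕ → ℝ → ℝ := fun i t => ((m.factorial : ℝ)⁻¹ * (x i - t) ^ m) * D t
  have hint : ∀ i, IntegrableOn (k i) (Set.Ioc 0 (x i)) := fun i => by
    have hDi := hDc.mono (Set.Icc_subset_Ici_self (a := x i) (b := 0))
    have hk : ContinuousOn (k i) (Set.Icc 0 (x i)) := by fun_prop
    exact hk.integrableOn_Icc.mono_set Set.Ioc_subset_Icc_self
  have hset : ∀ i, Set.Ioi (0 : ℝ) ∩ Set.Iic (x i) = Set.Ioc 0 (x i) := fun i =>
    Set.Ioi_inter_Iic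
  have hW : ∀ s, D s * Wp (m + 1) n x w s =
      ∑ i ∈ Finset.range n, w i * (Set.Iic (x i)).indicator (k i) s := by
    intro s
    simp only [Wp, Finset.sum_filter, Finset.mul_sum, Nat.add_sub_cancel]
    refine Finset.sum_congr rfl fun i _ => ?_
    by_cases h : s ≤ x i
    · simp only [h, if_true, Set.indicator_of_mem (Set.mem_Iic.2 h), k]
      ring
    · simp [h]
  have hindint : ∀ i, Integrable ((Set.Iic (x i)).indicator (k i))
      (volume.restrict (Set.Ioi 0)) := fun i => by
    rw [integrable_indicator_iff measurableSet_Iic, IntegrableOn,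
      Measure.restrict_restrict measurableSet_Iic, Set.inter_comm, hset]
    exact hint i
  have hindval : ∀ i, ∫ s in Set.Ioi (0 : ℝ), (Set.Iic (x i)).indicator (k i) s =
      f (x i) - taylorWithinEval f m (Set.Ici 0) 0 (x i) := fun i => by
    rw [setIntegral_indicator measurableSet_Iic, hset,
      sub_taylorWithinEval_Ici_eq_integral (hx i) hf,
      intervalIntegral.integral_of_le (hx i)]
  simp_rw [hW]
  rw [integral_finsetSum _ fun i _ => (hindint i).const_mul (w i)]
  simp_rw [integral_const_mul, hindval, mul_sub]
  rw [Finset.sum_sub_distrib, sum_mul_taylorWithinEval_zero _ m x w hw1 hwj]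
end

section
/- Let p ≥ 1 be an integer, C > 0, let x_1, …, x_n ≥ 0 and weights w_1, …, w_n ∈ ℝ satisfy Σ_{i=1}^n w_i = 1 and Σ_{i=1}^n w_i x_i^j = 0 for j = 1, …, p−1. Let F_{Höl}^p(C) be the set of all f : [0,∞) → ℝ that are p−1 times differentiable with |f^{(p−1)}(x) − f^{(p−1)}(x')| ≤ C|x − x'| for all x, x' ≥ 0. Then sup_{f ∈ F_{Höl}^p(C)} ( Σ_{i=1}^n w_i f(x_i) − f(0) ) = C ∫_0^∞ |W_p(s)| ds, where W_p(s) = (1/(p−1)!) Σ_{i : x_i ≥ s} w_i (x_i − s)^{p−1}; the supremum is attained by a p-th order spline whose p-th derivative equals C·sign(W_p(s)) at almost every s ≥ 0. -/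
open MeasureTheory

/-- The Hölder class `F_{Höl}^p(C)` on `[0,∞)`: functions that are `p−1` times
continuously differentiable on `[0,∞)` with `(p−1)`-th derivative Lipschitz with constant
`C` there. -/
def HolderClass (p : ℕ) (C : ℝ) : Set (ℝ → ℝ) :=
  {f | ContDiffOn ℝ (p - 1) f (Set.Ici 0) ∧
    ∀ x ∈ Set.Ici (0 : ℝ), ∀ x' ∈ Set.Ici (0 : ℝ),
      |iteratedDerivWithin (p - 1) f (Set.Ici 0) x -
        iteratedDerivWithin (p - 1) f (Set.Ici 0) x'| ≤ C * |x - x'|}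

open Set

lemma exists_contDiff_iteratedDeriv_eq {g : ℝ → ℝ} (hg : Continuous g) (q : ℕ) :
    ∃ f : ℝ → ℝ, ContDiff ℝ q f ∧ iteratedDeriv q f = g := by
  induction q with
  | zero => exact ⟨g, by simpa using hg, iteratedDeriv_zero⟩
  | succ q ih =>
    obtain ⟨f, hf, hfg⟩ := ih
    have hd (t : ℝ) : HasDerivAt (fun t => ∫ s in (0 : ℝ)..t, f s) (f t) t :=
      hf.continuous.integral_hasStrictDerivAt 0 t |>.hasDerivAt
    have hd' : deriv (fun t => ∫ s in (0 : ℝ)..t, f s) = f := funext fun t => (hd t).deriv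
    refine ⟨fun t => ∫ s in (0 : ℝ)..t, f s, ?_, ?_⟩
    · push_cast
      rw [contDiff_succ_iff_deriv]
      exact ⟨fun t => (hd t).differentiableAt, by simp, hd'.symm ▸ hf⟩
    · rw [iteratedDeriv_succ', hd', hfg]

lemma Real.measurable_sign : Measurable Real.sign := by
  unfold Real.sign
  exact Measurable.ite measurableSet_Iio measurable_const
    (Measurable.ite measurableSet_Ioi measurable_const measurable_const)

lemma taylor_remainder_Ici {f : ℝ → ℝ} {q : ℕ} {K : NNReal}
    (hf : ContDiffOn ℝ q f (Ici 0))
    (hL : LipschitzOnWith K (iteratedDerivWithin q f (Ici 0)) (Ici 0)) {x : ℝ} (hx : 0 ≤ x) :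
    f x = ∑ k ∈ Finset.range (q + 1),
        x ^ k * ((k.factorial : ℝ)⁻¹ * iteratedDerivWithin k f (Ici 0) 0) +
      ∫ t in (0 : ℝ)..x, (x - t) ^ q / q.factorial * iteratedDerivWithin (q + 1) f (Ici 0) t := by
  rcases hx.eq_or_lt with rfl | hx
  · simp [Finset.sum_range_succ']
  have hsub : uIcc 0 x ⊆ Ici 0 := by rw [uIcc_of_le hx.le]; exact Icc_subset_Ici_self
  have hU : UniqueDiffOn ℝ (uIcc 0 x) := by rw [uIcc_of_le hx.le]; exact uniqueDiffOn_Icc hx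
  have heq {k : ℕ} (hk : k ≤ q) :
      EqOn (iteratedDerivWithin k f (uIcc 0 x)) (iteratedDerivWithin k f (Ici 0)) (uIcc 0 x) := by
    intro t ht
    simp only [iteratedDerivWithin]
    rw [iteratedFDerivWithin_subset hsub hU (uniqueDiffOn_Ici 0)
      (hf.of_le (by exact_mod_cast hk)) ht]
  have hlip : LipschitzOnWith K (iteratedDerivWithin q f (uIcc 0 x)) (uIcc 0 x) :=
    fun s hs t ht => by rw [heq le_rfl hs, heq le_rfl ht]; exact hL (hsub hs) (hsub ht)
  have h := taylor_integral_remainder_of_absolutelyContinuous (hf.mono hsub)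
    hlip.absolutelyContinuousOnInterval
  rw [sub_eq_iff_eq_add', taylor_within_apply] at h
  rw [h]
  congr 1
  · refine Finset.sum_congr rfl fun k hk => ?_
    rw [heq (by grind) left_mem_uIcc, smul_eq_mul, sub_zero]
    ring
  · refine intervalIntegral.integral_congr_uIoo fun t ht => ?_
    rw [uIoo_of_le hx.le] at ht
    rw [iteratedDerivWithin_succ, iteratedDerivWithin_succ,
      derivWithin_of_mem_nhds (Ici_mem_nhds ht.1), derivWithin_of_mem_nhds
        (by rw [uIcc_of_le hx.le]; exact Icc_mem_nhds ht.1 ht.2)]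
    congr 1
    apply Filter.EventuallyEq.deriv_eq
    filter_upwards [Icc_mem_nhds ht.1 ht.2] with y hy
    exact heq le_rfl (by rwa [uIcc_of_le hx.le])

/-- The kernel `s ↦ (a - s)₊ ^ q / q!` of the Taylor remainder of order `q` at `a`, with the
convention `0 ^ 0 = 1` at `s = a`. -/
noncomputable def taylorKernel (q : ℕ) (a s : ℝ) : ℝ :=
  (Iic a).indicator (fun s => (a - s) ^ q / q.factorial) s

lemma Wp_succ_eq_sum_taylorKernel (q n : ℕ) (x w : ℕ → ℝ) (s : ℝ) :
    Wp (q + 1) n x w s = ∑ i ∈ Finset.range n, w i * taylorKernel q (x i) s := by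
  simp only [Wp, taylorKernel, indicator_apply, mem_Iic, Nat.add_sub_cancel, Finset.sum_filter,
    Finset.mul_sum]
  refine Finset.sum_congr rfl fun i _ => ?_
  split_ifs <;> ring

lemma integrableOn_mul_taylorKernel {F : ℝ → ℝ} {K : ℝ}
    (hF : AEStronglyMeasurable F (volume.restrict (Ioi 0))) (hK : ∀ s ∈ Ioi (0 : ℝ), |F s| ≤ K)
    (q : ℕ) (a : ℝ) :
    IntegrableOn (fun s => F s * taylorKernel q a s) (Ioi 0) := by
  have h : IntegrableOn (taylorKernel q a) (Ioi 0) := by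
    rw [IntegrableOn]
    unfold taylorKernel
    rw [integrable_indicator_iff measurableSet_Iic, IntegrableOn,
      Measure.restrict_restrict measurableSet_Iic, Iic_inter_Ioi]
    exact (Continuous.integrableOn_Icc (by fun_prop)).mono_set Ioc_subset_Icc_self
  exact Integrable.bdd_mul h hF ((ae_restrict_iff' measurableSet_Ioi).2 (.of_forall hK))

lemma setIntegral_mul_taylorKernel (F : ℝ → ℝ) (q : ℕ) {a : ℝ} (ha : 0 ≤ a) :
    ∫ s in Ioi (0 : ℝ), F s * taylorKernel q a s =
      ∫ s in (0 : ℝ)..a, (a - s) ^ q / q.factorial * F s := by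
  have h (s : ℝ) : F s * taylorKernel q a s =
      (Iic a).indicator (fun s => (a - s) ^ q / q.factorial * F s) s := by
    simp only [taylorKernel, indicator_apply]
    split_ifs <;> ring
  simp_rw [h]
  rw [setIntegral_indicator measurableSet_Iic, Ioi_inter_Iic,
    intervalIntegral.integral_of_le ha]

section

variable {q n : ℕ} {x w : ℕ → ℝ} {f : ℝ → ℝ} {C : ℝ}

lemma measurable_Wp_succ : Measurable (Wp (q + 1) n x w) := by
  simp_rw [funext (Wp_succ_eq_sum_taylorKernel q n x w)]
  refine Finset.measurable_sum _ fun i _ => .const_mul ?_ _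
  exact Measurable.indicator (by fun_prop) measurableSet_Iic

lemma mem_holderClass_succ_iff (hC : 0 ≤ C) :
    f ∈ HolderClass (q + 1) C ↔ ContDiffOn ℝ q f (Ici 0) ∧
      LipschitzOnWith C.toNNReal (iteratedDerivWithin q f (Ici 0)) (Ici 0) := by
  have hq : (((q + 1 : ℕ) : WithTop ℕ∞) - 1) = q := by norm_cast
  rw [HolderClass, mem_ofPred_eq, hq, lipschitzOnWith_iff_dist_le_mul]
  simp [Real.dist_eq, Real.coe_toNNReal _ hC]

lemma iteratedDerivWithin_succ_eqOn :
    EqOn (iteratedDerivWithin (q + 1) f (Ici 0)) (deriv (iteratedDerivWithin q f (Ici 0)))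
      (Ioi 0) := fun s hs => by
  rw [iteratedDerivWithin_succ, derivWithin_of_mem_nhds (Ici_mem_nhds hs)]

lemma abs_iteratedDerivWithin_le (hC : 0 ≤ C) (hf : f ∈ HolderClass (q + 1) C) :
    ∀ s ∈ Ioi (0 : ℝ), |iteratedDerivWithin (q + 1) f (Ici 0) s| ≤ C := fun s hs => by
  rw [iteratedDerivWithin_succ_eqOn hs, ← Real.norm_eq_abs, ← Real.coe_toNNReal C hC]
  exact norm_deriv_le_of_lipschitzOn (Ici_mem_nhds hs) ((mem_holderClass_succ_iff hC).1 hf).2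

lemma aestronglyMeasurable_iteratedDerivWithin_succ :
    AEStronglyMeasurable (iteratedDerivWithin (q + 1) f (Ici 0)) (volume.restrict (Ioi 0)) :=
  (measurable_deriv _).aestronglyMeasurable.congr
    ((ae_restrict_iff' measurableSet_Ioi).2 (.of_forall fun _ hs =>
      (iteratedDerivWithin_succ_eqOn hs).symm))

lemma integrableOn_mul_Wp {F : ℝ → ℝ} {K : ℝ}
    (hF : AEStronglyMeasurable F (volume.restrict (Ioi 0)))
    (hK : ∀ s ∈ Ioi (0 : ℝ), |F s| ≤ K) :
    IntegrableOn (fun s => F s * Wp (q + 1) n x w s) (Ioi 0) := by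
  simp_rw [Wp_succ_eq_sum_taylorKernel, Finset.mul_sum, mul_left_comm (F _)]
  exact integrable_finsetSum _ fun i _ => (integrableOn_mul_taylorKernel hF hK q (x i)).const_mul _

/-- Taylor-remainder representation of the bias of a linear estimator of `f 0` whose weights
reproduce polynomials of degree at most `q`. -/
lemma bias_eq_setIntegral (hC : 0 ≤ C) (hx : ∀ i, 0 ≤ x i)
    (hw1 : ∑ i ∈ Finset.range n, w i = 1)
    (hwj : ∀ j : ℕ, 1 ≤ j → j ≤ q → ∑ i ∈ Finset.range n, w i * x i ^ j = 0)
    (hf : f ∈ HolderClass (q + 1) C) :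
    ∑ i ∈ Finset.range n, w i * f (x i) - f 0 =
      ∫ s in Ioi (0 : ℝ), iteratedDerivWithin (q + 1) f (Ici 0) s * Wp (q + 1) n x w s := by
  have hF := abs_iteratedDerivWithin_le hC hf
  obtain ⟨hd, hL⟩ := (mem_holderClass_succ_iff hC).1 hf
  have hpoly : ∑ i ∈ Finset.range n, w i * ∑ k ∈ Finset.range (q + 1),
      x i ^ k * ((k.factorial : ℝ)⁻¹ * iteratedDerivWithin k f (Ici 0) 0) = f 0 := by
    simp_rw [Finset.mul_sum, ← mul_assoc]
    rw [Finset.sum_comm, Finset.sum_range_succ', Finset.sum_eq_zero]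
    · simp [← Finset.sum_mul, hw1]
    · intro k hk
      simp_rw [← Finset.sum_mul]
      rw [hwj (k + 1) (by omega) (by grind)]
      ring
  have hrep (i : ℕ) : w i * f (x i) = _ :=
    congrArg (w i * ·) (taylor_remainder_Ici hd hL (hx i))
  simp_rw [hrep, mul_add, Finset.sum_add_distrib, hpoly, add_sub_cancel_left,
    Wp_succ_eq_sum_taylorKernel, Finset.mul_sum, mul_left_comm (iteratedDerivWithin _ _ _ _)]
  rw [integral_finsetSum _ fun i _ => (integrableOn_mul_taylorKernel
    aestronglyMeasurable_iteratedDerivWithin_succ hF q (x i)).const_mul _]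
  simp_rw [integral_const_mul, setIntegral_mul_taylorKernel _ q (hx _)]

lemma bias_le (hC : 0 ≤ C) (hx : ∀ i, 0 ≤ x i)
    (hw1 : ∑ i ∈ Finset.range n, w i = 1)
    (hwj : ∀ j : ℕ, 1 ≤ j → j ≤ q → ∑ i ∈ Finset.range n, w i * x i ^ j = 0)
    (hf : f ∈ HolderClass (q + 1) C) :
    ∑ i ∈ Finset.range n, w i * f (x i) - f 0 ≤
      C * ∫ s in Ioi (0 : ℝ), |Wp (q + 1) n x w s| := by
  have hF := abs_iteratedDerivWithin_le hC hf
  have hW : IntegrableOn (Wp (q + 1) n x w) (Ioi 0) := by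
    simpa using integrableOn_mul_Wp (F := fun _ => 1) (K := 1) (q := q) (n := n) (x := x) (w := w)
      aestronglyMeasurable_const (by simp)
  rw [bias_eq_setIntegral hC hx hw1 hwj hf, ← integral_const_mul]
  refine setIntegral_mono_on
    (integrableOn_mul_Wp aestronglyMeasurable_iteratedDerivWithin_succ hF)
    (hW.abs.const_mul C) measurableSet_Ioi fun s hs => ?_
  calc _ ≤ |iteratedDerivWithin (q + 1) f (Ici 0) s * Wp (q + 1) n x w s| := le_abs_self _
    _ ≤ _ := by
      rw [abs_mul]
      exact mul_le_mul_of_nonneg_right (hF s hs) (abs_nonneg _)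

end

/-- A bounded measurable function is almost everywhere on `[0, ∞)` the derivative of order `q + 1`
of a member of the Hölder class. -/
lemma exists_mem_holderClass_iteratedDerivWithin_ae_eq {h : ℝ → ℝ} {C : ℝ} (hh : Measurable h)
    (hC : 0 ≤ C) (hb : ∀ s, |h s| ≤ C) (q : ℕ) :
    ∃ f ∈ HolderClass (q + 1) C, ∀ᵐ s ∂(volume.restrict (Ioi (0 : ℝ))),
      iteratedDerivWithin (q + 1) f (Ici 0) s = h s := by
  have hloc : LocallyIntegrable h volume :=
    (locallyIntegrable_const C).mono hh.aestronglyMeasurable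
      (.of_forall fun s => by simpa [abs_of_nonneg hC] using hb s)
  have hint (a b : ℝ) : IntervalIntegrable h volume a b :=
    (hloc.integrableOn_isCompact isCompact_uIcc).intervalIntegrable
  have hlip : LipschitzWith C.toNNReal fun t => ∫ s in (0 : ℝ)..t, h s := by
    refine LipschitzWith.of_dist_le_mul fun s t => ?_
    rw [Real.dist_eq, Real.dist_eq, intervalIntegral.integral_interval_sub_left (hint _ _)
      (hint _ _), Real.coe_toNNReal C hC]
    exact intervalIntegral.norm_integral_le_of_norm_le_const (f := h) fun u _ => hb u
  obtain ⟨f, hf, hfg⟩ := exists_contDiff_iteratedDeriv_eq hlip.continuous q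
  have heq : EqOn (iteratedDerivWithin q f (Ici 0)) (fun t => ∫ s in (0 : ℝ)..t, h s) (Ici 0) :=
    fun t ht => by
      rw [iteratedDerivWithin_eq_iteratedDeriv (uniqueDiffOn_Ici 0) hf.contDiffAt ht, hfg]
  refine ⟨f, (mem_holderClass_succ_iff hC).2 ⟨hf.contDiffOn, fun s hs t ht => ?_⟩, ?_⟩
  · rw [heq hs, heq ht]
    exact hlip s t
  · rw [ae_restrict_iff' measurableSet_Ioi]
    filter_upwards [LocallyIntegrable.ae_hasDerivAt_integral hloc] with s hs hs0
    rw [iteratedDerivWithin_succ_eqOn hs0, ← (hs 0).deriv]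
    apply Filter.EventuallyEq.deriv_eq
    filter_upwards [Ici_mem_nhds hs0] with t ht using heq ht

lemma Real.abs_sign_le_one (r : ℝ) : |Real.sign r| ≤ 1 := by
  obtain h | h | h := Real.sign_apply_eq r <;> simp [h]

lemma Real.sign_mul_self (r : ℝ) : Real.sign r * r = |r| := by
  obtain h | rfl | h := lt_trichotomy r 0
  · simp [Real.sign_of_neg h, abs_of_neg h]
  · simp
  · simp [Real.sign_of_pos h, abs_of_pos h]

/-- finite-sample worst-case bias over the Hölder class in the boundary
case.  For weights summing to one and annihilating `x^j`, `j = 1, …, p−1`, the maximal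
bias `Σ w_i f(x_i) − f(0)` over `F_{Höl}^p(C)` equals `C ∫_0^∞ |W_p(s)| ds`, attained by a
`p`-th order spline whose `p`-th derivative equals `C·sign(W_p(s))` at almost every
`s ≥ 0`. -/
theorem stmt18 (p : ℕ) (hp : 1 ≤ p) (C : ℝ) (hC : 0 < C) (n : ℕ) (x w : ℕ → ℝ)
    (hx : ∀ i, 0 ≤ x i)
    (hw1 : ∑ i ∈ Finset.range n, w i = 1)
    (hwj : ∀ j : ℕ, 1 ≤ j → j ≤ p - 1 → ∑ i ∈ Finset.range n, w i * x i ^ j = 0) :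
    IsGreatest {y : ℝ | ∃ f ∈ HolderClass p C,
        y = ∑ i ∈ Finset.range n, w i * f (x i) - f 0}
      (C * ∫ s in Set.Ioi (0 : ℝ), |Wp p n x w s|) ∧
    ∃ f ∈ HolderClass p C,
      (∀ᵐ s ∂(volume.restrict (Set.Ioi (0 : ℝ))),
        iteratedDerivWithin p f (Set.Ici 0) s = C * Real.sign (Wp p n x w s)) ∧
      ∑ i ∈ Finset.range n, w i * f (x i) - f 0
        = C * ∫ s in Set.Ioi (0 : ℝ), |Wp p n x w s| := by
  obtain ⟨q, rfl⟩ : ∃ q, p = q + 1 := ⟨p - 1, by omega⟩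
  rw [Nat.add_sub_cancel] at hwj
  obtain ⟨f, hf, hfs⟩ := exists_mem_holderClass_iteratedDerivWithin_ae_eq
    (h := fun s => C * Real.sign (Wp (q + 1) n x w s))
    ((Real.measurable_sign.comp measurable_Wp_succ).const_mul C) hC.le
    (fun s => by
      rw [abs_mul, abs_of_pos hC]
      exact mul_le_of_le_one_right hC.le (Real.abs_sign_le_one _)) q
  have hbias : ∑ i ∈ Finset.range n, w i * f (x i) - f 0 =
      C * ∫ s in Set.Ioi (0 : ℝ), |Wp (q + 1) n x w s| := by
    rw [bias_eq_setIntegral hC.le hx hw1 hwj hf, ← integral_const_mul]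
    refine integral_congr_ae ?_
    filter_upwards [hfs] with s hs
    rw [hs, mul_assoc, Real.sign_mul_self]
  refine ⟨⟨⟨f, hf, hbias.symm⟩, ?_⟩, f, hf, hfs, hbias⟩
  rintro _ ⟨g, hg, rfl⟩
  exact bias_le hC.le hx hw1 hwj hg
end
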